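/- Let 𝒜 be an abelian category and 𝒞 a full additive subcategory such that 𝒞⊥𝒞 holds and 𝒞 is closed under direct summands, and let 𝒟 be a full additive subcategory of 𝒜 contained in 𝒢(𝒞)^⊥. Then for every object A in 𝒞^⊥ with 𝒟-codim A < ∞, one has 𝒢(𝒞)-dim A = 𝒞-dim A. -/

import Mathlib

open CategoryTheory CategoryTheory.Limits CategoryTheory.Abelian ZeroObject

universe w v u

namespace RelHomDim

variable {𝒜 : Type u} [Category.{v} 𝒜] [Abelian 𝒜]

/-- A class of objects of an abelian category corresponding to a full additive
subcategory: it is closed under isomorphisms, contains a zero object and is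
closed under finite direct sums (biproducts). -/
def IsAdditiveClass (P : 𝒜 → Prop) : Prop :=
  P 0 ∧ (∀ ⦃X Y : 𝒜⦄, (X ≅ Y) → P X → P Y) ∧ ∀ ⦃X Y : 𝒜⦄, P X → P Y → P (X ⊞ Y)

/-- A class of objects is closed under direct summands. -/
def ClosedUnderSummands (P : 𝒜 → Prop) : Prop :=
  ∀ X Y : 𝒜, P (X ⊞ Y) → P X ∧ P Y

/-- `Hom(W,-)`-exactness of a short exact sequence `0 → X₁ → X₂ → X₃ → 0`:
the induced sequence `0 → Hom(W,X₁) → Hom(W,X₂) → Hom(W,X₃) → 0` is exact. -/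
def CovHomExact (W : 𝒜) (S : ShortComplex 𝒜) : Prop :=
  (∀ a b : W ⟶ S.X₁, a ≫ S.f = b ≫ S.f → a = b) ∧
  (∀ b : W ⟶ S.X₂, b ≫ S.g = 0 → ∃ a : W ⟶ S.X₁, a ≫ S.f = b) ∧
  (∀ c : W ⟶ S.X₃, ∃ b : W ⟶ S.X₂, b ≫ S.g = c)

/-- A short exact sequence is `ℰ`-proper (i.e. `Hom(ℰ,-)`-exact) if it is
`Hom(E,-)`-exact for every object `E` in the class `ℰ`. -/
def EProper (E : 𝒜 → Prop) (S : ShortComplex 𝒜) : Prop :=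
  ∀ W, E W → CovHomExact W S

/-- `ResW P W n K A` holds iff there is an exact sequence
`0 → K → X_{n-1} → ⋯ → X_0 → A → 0` in `𝒜` with all the `n` middle terms `X i`
in `P`, such that each of the short exact sequences obtained by splicing
satisfies `W` (this encodes, e.g., `Hom(ℰ,-)`-exactness of the whole sequence). -/
def ResW (P : 𝒜 → Prop) (W : ShortComplex 𝒜 → Prop) : ℕ → 𝒜 → 𝒜 → Prop
  | 0 => fun K A => Nonempty (K ≅ A)
  | n + 1 => fun K A => ∃ (B X : 𝒜) (f : B ⟶ X) (g : X ⟶ A) (w : f ≫ g = 0),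
      P X ∧ (ShortComplex.mk f g w).ShortExact ∧ W (ShortComplex.mk f g w) ∧
      ResW P W n K B

/-- `Res P n K A` : there is an exact sequence `0 → K → X_{n-1} → ⋯ → X_0 → A → 0`
with all middle terms in `P`. -/
abbrev Res (P : 𝒜 → Prop) : ℕ → 𝒜 → 𝒜 → Prop := ResW P fun _ => True

/-- `CoresW P W n A K` holds iff there is an exact sequence
`0 → A → X^0 → ⋯ → X^{n-1} → K → 0` with all middle terms in `P` and each
spliced short exact piece satisfying `W`. -/
def CoresW (P : 𝒜 → Prop) (W : ShortComplex 𝒜 → Prop) : ℕ → 𝒜 → 𝒜 → Prop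
  | 0 => fun A K => Nonempty (A ≅ K)
  | n + 1 => fun A K => ∃ (X B : 𝒜) (f : A ⟶ X) (g : X ⟶ B) (w : f ≫ g = 0),
      P X ∧ (ShortComplex.mk f g w).ShortExact ∧ W (ShortComplex.mk f g w) ∧
      CoresW P W n B K

/-- `Cores P n A K` : there is an exact sequence `0 → A → X^0 → ⋯ → X^{n-1} → K → 0`
with all middle terms in `P`. -/
abbrev Cores (P : 𝒜 → Prop) : ℕ → 𝒜 → 𝒜 → Prop := CoresW P fun _ => True

/-- The `P`-dimension of `A` : the infimum of the `n ≥ 0` such that there is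
an exact sequence `0 → C_n → ⋯ → C_1 → C_0 → A → 0` with all `C_i` in `P`
(`⊤ = ∞` if there is no such `n`). -/
noncomputable def rdim (P : 𝒜 → Prop) (A : 𝒜) : ℕ∞ :=
  sInf {c : ℕ∞ | ∃ n : ℕ, c = n ∧ ∃ K, P K ∧ Res P n K A}

/-- The `P`-codimension of `A` : the infimum of the `n ≥ 0` such that there is
an exact sequence `0 → A → C^0 → C^1 → ⋯ → C^n → 0` with all `C^i` in `P`
(`⊤ = ∞` if there is no such `n`). -/
noncomputable def rcodim (P : 𝒜 → Prop) (A : 𝒜) : ℕ∞ :=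
  sInf {c : ℕ∞ | ∃ n : ℕ, c = n ∧ ∃ K, P K ∧ Cores P n A K}

/-- `A` belongs to `P^⊥`, i.e. `Ext^i(C, A) = 0` for all `C` in `P` and `i ≥ 1`. -/
def MemRightPerp [HasExt.{w} 𝒜] (P : 𝒜 → Prop) (A : 𝒜) : Prop :=
  ∀ C, P C → ∀ i : ℕ, 1 ≤ i → Subsingleton (Abelian.Ext C A i)

/-- `A` belongs to `^⊥P`, i.e. `Ext^i(A, C) = 0` for all `C` in `P` and `i ≥ 1`. -/
def MemLeftPerp [HasExt.{w} 𝒜] (P : 𝒜 → Prop) (A : 𝒜) : Prop :=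
  ∀ C, P C → ∀ i : ℕ, 1 ≤ i → Subsingleton (Abelian.Ext A C i)

/-- `𝒞` is an `ℰ`-proper generator for `𝒯` (`𝒞 ⊆ 𝒯` and every object of `𝒯`
is an `ℰ`-proper quotient of an object of `𝒞` with kernel in `𝒯`). -/
def IsProperGenerator (E C T : 𝒜 → Prop) : Prop :=
  (∀ ⦃X⦄, C X → T X) ∧
  ∀ X, T X → ∃ (X' Cb : 𝒜) (f : X' ⟶ Cb) (g : Cb ⟶ X) (w : f ≫ g = 0),
    C Cb ∧ T X' ∧ (ShortComplex.mk f g w).ShortExact ∧ EProper E (ShortComplex.mk f g w)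

/-- `𝒞` is a cogenerator for `𝒯`. -/
def IsCogenerator (C T : 𝒜 → Prop) : Prop :=
  (∀ ⦃X⦄, C X → T X) ∧
  ∀ X, T X → ∃ (Cb X' : 𝒜) (f : X ⟶ Cb) (g : Cb ⟶ X') (w : f ≫ g = 0),
    C Cb ∧ T X' ∧ (ShortComplex.mk f g w).ShortExact

/-- `𝒯` is closed under `ℰ`-proper extensions. -/
def ClosedUnderProperExtensions (E T : 𝒜 → Prop) : Prop :=
  ∀ S : ShortComplex 𝒜, S.ShortExact → EProper E S → T S.X₁ → T S.X₃ → T S.X₂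

/-- `𝒯` is closed under kernels of `ℰ`-proper epimorphisms. -/
def ClosedUnderProperKernels (E T : 𝒜 → Prop) : Prop :=
  ∀ S : ShortComplex 𝒜, S.ShortExact → EProper E S → T S.X₂ → T S.X₃ → T S.X₁

/-- `𝒯` is an `ℰ`-preresolving subcategory with `ℰ`-proper generator `𝒞`. -/
def IsPreresolving (E T C : 𝒜 → Prop) : Prop :=
  IsProperGenerator E C T ∧ ClosedUnderProperExtensions E T


/-- Exactness of a four-term sequence `0 → M → T₁ → T₀ → A → 0`. -/
def FourTermExact {M T1 T0 A : 𝒜} (f : M ⟶ T1) (g : T1 ⟶ T0) (h : T0 ⟶ A) : Prop :=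
  Mono f ∧ Epi h ∧ ∃ (w₁ : f ≫ g = 0) (w₂ : g ≫ h = 0),
    (ShortComplex.mk f g w₁).Exact ∧ (ShortComplex.mk g h w₂).Exact

/-- `Hom(W,-)`-exactness of the four-term exact sequence `0 → M → T₁ → T₀ → A → 0` :
the induced sequence `0 → Hom(W,M) → Hom(W,T₁) → Hom(W,T₀) → Hom(W,A) → 0` is exact. -/
def CovHomExact4 (W : 𝒜) {M T1 T0 A : 𝒜} (f : M ⟶ T1) (g : T1 ⟶ T0) (h : T0 ⟶ A) : Prop :=
  (∀ a b : W ⟶ M, a ≫ f = b ≫ f → a = b) ∧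
  (∀ b : W ⟶ T1, b ≫ g = 0 → ∃ a : W ⟶ M, a ≫ f = b) ∧
  (∀ c : W ⟶ T0, c ≫ h = 0 → ∃ b : W ⟶ T1, b ≫ g = c) ∧
  (∀ d : W ⟶ A, ∃ c : W ⟶ T0, c ≫ h = d)

/-- There is an exact sequence `0 → M → K⁰ → C¹ → ⋯ → Cⁿ → 0` with `K⁰` in `T`
and all `C^i` in `C`. -/
def MixedCores (T C : 𝒜 → Prop) : ℕ → 𝒜 → Prop
  | 0 => fun M => ∃ K, T K ∧ Nonempty (M ≅ K)
  | n + 1 => fun M => ∃ (K H : 𝒜) (f : M ⟶ K) (g : K ⟶ H) (w : f ≫ g = 0),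
      T K ∧ (ShortComplex.mk f g w).ShortExact ∧ ∃ K', C K' ∧ Cores C n H K'

/-- The Gorenstein subcategory `𝒢(𝒞)` : objects `A` admitting a doubly infinite
exact sequence `⋯ → X_{-1} → X_0 → X_1 → ⋯` with all terms in `𝒞`, which is both
`Hom(𝒞,-)`-exact and `Hom(-,𝒞)`-exact, such that `A ≅ Im(X_0 → X_1)`. -/
def IsGorenstein (P : 𝒜 → Prop) (A : 𝒜) : Prop :=
  ∃ (X : ℤ → 𝒜) (d : ∀ i : ℤ, X i ⟶ X (i + 1)) (w : ∀ i, d i ≫ d (i + 1) = 0),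
    (∀ i, P (X i)) ∧
    (∀ i, (ShortComplex.mk (d i) (d (i + 1)) (w i)).Exact) ∧
    (∀ C, P C → ∀ (i : ℤ) (f : C ⟶ X (i + 1)), f ≫ d (i + 1) = 0 →
      ∃ g : C ⟶ X i, g ≫ d i = f) ∧
    (∀ C, P C → ∀ (i : ℤ) (f : X (i + 1) ⟶ C), d i ≫ f = 0 →
      ∃ g : X (i + 1 + 1) ⟶ C, d (i + 1) ≫ g = f) ∧
    Nonempty (A ≅ Limits.image (d 0))

end RelHomDim

namespace RelHomDim

section ShortExactSequences

variable {𝒜 : Type u} [Category.{v} 𝒜] [Abelian 𝒜]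

/-- There is a short exact sequence `0 → U → V → W → 0`. -/
def SES (U V W : 𝒜) : Prop :=
  ∃ (f : U ⟶ V) (g : V ⟶ W) (w : f ≫ g = 0), (ShortComplex.mk f g w).ShortExact

lemma shortExact_of_desc {U V W : 𝒜} (f : U ⟶ V) (g : V ⟶ W) (w : f ≫ g = 0) [Mono f] [Epi g]
    (h : ∀ (T : 𝒜) (k : V ⟶ T), f ≫ k = 0 → ∃ l, g ≫ l = k) :
    (ShortComplex.mk f g w).ShortExact where
  exact := ShortComplex.exact_of_g_is_cokernel _
    (CokernelCofork.IsColimit.ofπ' _ _ fun k hk => ⟨_, (h _ k hk).choose_spec⟩)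

lemma SES.op {U V W : 𝒜} : SES U V W →
    SES (Opposite.op W) (Opposite.op V) (Opposite.op U) := by
  rintro ⟨f, g, w, h⟩
  exact ⟨_, _, _, h.op⟩

lemma SES.unop {U V W : 𝒜ᵒᵖ} : SES U V W → SES W.unop V.unop U.unop := by
  rintro ⟨f, g, w, h⟩
  exact ⟨_, _, _, h.unop⟩

lemma SES.of_pushout {U V W V' : 𝒜} (f : U ⟶ V) (g : V ⟶ W) (w : f ≫ g = 0)
    (h : (ShortComplex.mk f g w).ShortExact) (f' : U ⟶ V') :
    SES V' (pushout f f') W := by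
  have : Mono f := h.mono_f
  have : Epi g := h.epi_g
  have w' : f ≫ g = f' ≫ 0 := by simp [w]
  have hg : pushout.inl f f' ≫ pushout.desc g 0 w' = g := pushout.inl_desc _ _ _
  have : Epi (pushout.desc g 0 w' : pushout f f' ⟶ W) := by
    have : Epi (pushout.inl f f' ≫ pushout.desc g 0 w') := by rwa [hg]
    exact epi_of_epi (pushout.inl f f') _
  refine ⟨pushout.inr f f', pushout.desc g 0 w', pushout.inr_desc _ _ _,
    shortExact_of_desc _ _ _ fun T k hk => ?_⟩
  obtain ⟨l, hl⟩ := CokernelCofork.IsColimit.desc' h.gIsCokernel (pushout.inl f f' ≫ k)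
    (by dsimp; rw [pushout.condition_assoc, hk, comp_zero])
  dsimp at l hl
  refine ⟨l, pushout.hom_ext ?_ ?_⟩
  · rw [pushout.inl_desc_assoc, hl]
  · rw [pushout.inr_desc_assoc, hk, zero_comp]

lemma SES.exists_pushout {U V W V' W' : 𝒜} : SES U V W → SES U V' W' →
    ∃ P, SES V P W' ∧ SES V' P W := by
  rintro ⟨f, g, w, h⟩ ⟨f', g', w', h'⟩
  obtain ⟨a, b, c, e⟩ := SES.of_pushout f' g' w' h' f
  have i : pushout f' f ≅ pushout f f' := pushoutSymmetry _ _
  refine ⟨pushout f f', ⟨a ≫ i.hom, i.inv ≫ b, by simp [c], ?_⟩, SES.of_pushout f g w h f'⟩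
  exact ShortComplex.shortExact_of_iso (S₁ := .mk a b c)
    (ShortComplex.isoMk (Iso.refl _) i (Iso.refl _)) e

lemma SES.of_iso_left {U U' V W : 𝒜} (i : U' ≅ U) : SES U V W → SES U' V W := by
  rintro ⟨f, g, w, h⟩
  exact ⟨i.hom ≫ f, g, by simp [w], ShortComplex.shortExact_of_iso (S₁ := .mk f g w)
    (ShortComplex.isoMk i.symm (Iso.refl _) (Iso.refl _)) h⟩

lemma SES.exists_quotient {U V A W P : 𝒜} : SES U V A → SES V W P →
    ∃ Y, SES U W Y ∧ SES A Y P := by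
  rintro ⟨f, g, w, h⟩ ⟨f', g', w', h'⟩
  have : Mono f := h.mono_f
  have : Epi g := h.epi_g
  have : Mono f' := h'.mono_f
  refine ⟨pushout f' g, ⟨f ≫ f', pushout.inl f' g, ?_, ?_⟩, SES.of_pushout f' g' w' h' g⟩
  · rw [Category.assoc, pushout.condition, reassoc_of% w, zero_comp]
  · refine shortExact_of_desc _ _ _ fun T k hk => ?_
    obtain ⟨l, hl⟩ := CokernelCofork.IsColimit.desc' h.gIsCokernel (f' ≫ k) (by simpa using hk)
    exact ⟨pushout.desc k l hl.symm, pushout.inl_desc _ _ _⟩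

lemma SES.exists_subobject {A Y G K C : 𝒜} (h : SES A Y G) (h' : SES K C Y) :
    ∃ Z, SES Z C G ∧ SES K Z A := by
  obtain ⟨Z, hZ, hZ'⟩ := SES.exists_quotient h.op h'.op
  exact ⟨Z.unop, hZ.unop, hZ'.unop⟩

lemma SES.biprod_left {U V W : 𝒜} (X : 𝒜) : SES U V W → SES (X ⊞ U) (X ⊞ V) W := by
  rintro ⟨f, g, w, h⟩
  have : Mono f := h.mono_f
  have : Epi g := h.epi_g
  have : Mono (biprod.map (𝟙 X) f) := by
    refine ⟨fun a b hab => biprod.hom_ext _ _ ?_ ?_⟩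
    · simpa using hab =≫ biprod.fst
    · simpa [← cancel_mono f] using hab =≫ biprod.snd
  have : Epi (biprod.snd ≫ g : X ⊞ V ⟶ W) := epi_comp _ _
  refine ⟨biprod.map (𝟙 X) f, biprod.snd ≫ g, by simp [w],
    shortExact_of_desc _ _ _ fun T k hk => ?_⟩
  have h₁ : biprod.inl ≫ k = 0 := by simpa using biprod.inl ≫= hk
  obtain ⟨l, hl⟩ := CokernelCofork.IsColimit.desc' h.gIsCokernel (biprod.inr ≫ k)
    (by simpa using biprod.inr ≫= hk)
  dsimp at l hl
  exact ⟨l, biprod.hom_ext' _ _ (by simp [h₁]) (by simp [hl])⟩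

lemma SES.of_iso {X Y : 𝒜} (i : X ≅ Y) : SES X Y 0 :=
  ⟨i.hom, 0, by simp, shortExact_of_desc _ _ _ fun T k hk => ⟨0, by
    rw [(cancel_epi i.hom).1 (hk.trans comp_zero.symm), comp_zero]⟩⟩

end ShortExactSequences

section Vanishing

variable {𝒜 : Type u} [Category.{v} 𝒜] [Abelian 𝒜] [HasExt.{w} 𝒜]

open Abelian.Ext

lemma subsingleton_ext_of_forall_eq_zero {X Y : 𝒜} {n : ℕ} (h : ∀ x : Ext X Y n, x = 0) :
    Subsingleton (Ext X Y n) :=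
  subsingleton_of_forall_eq 0 h

lemma subsingleton_ext_of_iso_left {X Y T : 𝒜} {n : ℕ} (i : X ≅ Y)
    (h : Subsingleton (Ext X T n)) : Subsingleton (Ext Y T n) := by
  refine subsingleton_ext_of_forall_eq_zero fun x => ?_
  have hx := mk₀_comp_mk₀_assoc i.inv i.hom x
  rw [h.elim ((mk₀ i.hom).comp x (zero_add n)) 0] at hx
  simpa using hx.symm

lemma subsingleton_ext_of_iso_right {X Y T : 𝒜} {n : ℕ} (i : X ≅ Y)
    (h : Subsingleton (Ext T X n)) : Subsingleton (Ext T Y n) := by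
  refine subsingleton_ext_of_forall_eq_zero fun x => ?_
  rw [← comp_mk₀_id x, ← i.inv_hom_id, ← mk₀_comp_mk₀, ← comp_assoc_of_third_deg_zero,
    h.elim (x.comp (mk₀ i.inv) (add_zero n)) 0, Abelian.Ext.zero_comp]

lemma SES.subsingleton_ext_left_mid {U V W T : 𝒜} {n : ℕ} (h : SES U V W)
    (hU : Subsingleton (Ext U T n)) (hW : Subsingleton (Ext W T n)) :
    Subsingleton (Ext V T n) := by
  obtain ⟨f, g, w, h⟩ := h
  refine subsingleton_ext_of_forall_eq_zero fun x => ?_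
  obtain ⟨y, rfl⟩ := contravariant_sequence_exact₂ h _ x (hU.elim _ _)
  rw [hW.elim y 0, Abelian.Ext.comp_zero]

lemma SES.subsingleton_ext_left_fst {U V W T : 𝒜} {n : ℕ} (h : SES U V W)
    (hV : Subsingleton (Ext V T n)) (hW : Subsingleton (Ext W T (n + 1))) :
    Subsingleton (Ext U T n) := by
  obtain ⟨f, g, w, h⟩ := h
  refine subsingleton_ext_of_forall_eq_zero fun x => ?_
  obtain ⟨y, rfl⟩ := contravariant_sequence_exact₁ h _ x (add_comm 1 n) (hW.elim _ _)
  rw [hV.elim y 0, Abelian.Ext.comp_zero]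

lemma SES.subsingleton_ext_left_trd {U V W T : 𝒜} {n : ℕ} (h : SES U V W)
    (hU : Subsingleton (Ext U T n)) (hV : Subsingleton (Ext V T (n + 1))) :
    Subsingleton (Ext W T (n + 1)) := by
  obtain ⟨f, g, w, h⟩ := h
  refine subsingleton_ext_of_forall_eq_zero fun x => ?_
  obtain ⟨y, rfl⟩ := contravariant_sequence_exact₃ h _ x (hV.elim _ _) (add_comm 1 n)
  rw [hU.elim y 0, Abelian.Ext.comp_zero]

lemma SES.subsingleton_ext_right_mid {U V W T : 𝒜} {n : ℕ} (h : SES U V W)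
    (hU : Subsingleton (Ext T U n)) (hW : Subsingleton (Ext T W n)) :
    Subsingleton (Ext T V n) := by
  obtain ⟨f, g, w, h⟩ := h
  refine subsingleton_ext_of_forall_eq_zero fun x => ?_
  obtain ⟨y, rfl⟩ := covariant_sequence_exact₂ _ h x (hW.elim _ _)
  rw [hU.elim y 0, Abelian.Ext.zero_comp]

lemma SES.subsingleton_ext_right_fst {U V W T : 𝒜} {n : ℕ} (h : SES U V W)
    (hV : Subsingleton (Ext T V (n + 1))) (hW : Subsingleton (Ext T W n)) :
    Subsingleton (Ext T U (n + 1)) := by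
  obtain ⟨f, g, w, h⟩ := h
  refine subsingleton_ext_of_forall_eq_zero fun x => ?_
  obtain ⟨y, rfl⟩ := covariant_sequence_exact₁ _ h x (hV.elim _ _) rfl
  rw [hW.elim y 0, Abelian.Ext.zero_comp]

lemma SES.subsingleton_ext_right_trd {U V W T : 𝒜} {n : ℕ} (h : SES U V W)
    (hU : Subsingleton (Ext T U (n + 1))) (hV : Subsingleton (Ext T V n)) :
    Subsingleton (Ext T W n) := by
  obtain ⟨f, g, w, h⟩ := h
  refine subsingleton_ext_of_forall_eq_zero fun x => ?_
  obtain ⟨y, rfl⟩ := covariant_sequence_exact₃ _ h x rfl (hU.elim _ _)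
  rw [hV.elim y 0, Abelian.Ext.zero_comp]

lemma subsingleton_ext_one_of_extend {U V W T : 𝒜} (f : U ⟶ V) (g : V ⟶ W) (w : f ≫ g = 0)
    (h : (ShortComplex.mk f g w).ShortExact) (hV : Subsingleton (Ext V T 1))
    (hf : ∀ a : U ⟶ T, ∃ b : V ⟶ T, f ≫ b = a) : Subsingleton (Ext W T 1) := by
  refine subsingleton_ext_of_forall_eq_zero fun x => ?_
  obtain ⟨y, rfl⟩ := contravariant_sequence_exact₃ h _ x (hV.elim _ _) (add_zero 1)
  obtain ⟨a, rfl⟩ := (mk₀_bijective _ _).2 y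
  obtain ⟨b, rfl⟩ := hf a
  rw [← mk₀_comp_mk₀]
  exact h.extClass_comp_assoc _

lemma SES.nonempty_iso_biprod {U V W : 𝒜} (h : SES U V W) (hs : Subsingleton (Ext W U 1)) :
    Nonempty (V ≅ U ⊞ W) := by
  obtain ⟨f, g, w, h⟩ := h
  obtain ⟨y, hy⟩ := contravariant_sequence_exact₁ h _ (mk₀ (𝟙 U)) (add_zero 1) (hs.elim _ _)
  obtain ⟨r, rfl⟩ := (mk₀_bijective _ _).2 y
  rw [mk₀_comp_mk₀] at hy
  exact ⟨(ShortComplex.Splitting.ofExactOfRetraction _ h.exact r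
    ((mk₀_bijective _ _).1 hy) h.epi_g).isoBinaryBiproduct⟩

end Vanishing

section Gorenstein

variable {𝒜 : Type u} [Category.{v} 𝒜] [Abelian 𝒜]

lemma shortExact_image {X Y Z : 𝒜} (d : X ⟶ Y) (e : Y ⟶ Z) (w : d ≫ e = 0)
    (h : (ShortComplex.mk d e w).Exact) :
    ∃ w' : Limits.image.ι d ≫ factorThruImage e = 0,
      (ShortComplex.mk (Limits.image.ι d) (factorThruImage e) w').ShortExact := by
  have w' : Limits.image.ι d ≫ factorThruImage e = 0 := by
    rw [← cancel_epi (factorThruImage d), ← cancel_mono (Limits.image.ι e)]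
    simp [w]
  refine ⟨w', { exact := ?_ }⟩
  rw [ShortComplex.exact_iff_exact_up_to_refinements] at h ⊢
  intro T x hx
  dsimp at x hx ⊢
  obtain ⟨T', p, hp, y, hy⟩ := h x (by simpa using hx =≫ Limits.image.ι e)
  exact ⟨T', p, hp, y ≫ factorThruImage d, by simpa using hy⟩

lemma IsGorenstein.exists_ses {P : 𝒜 → Prop} {G : 𝒜} (hG : IsGorenstein P G) :
    ∃ C G', P C ∧ IsGorenstein P G' ∧ SES G C G' := by
  obtain ⟨X, d, w, hP, hE, h₁, h₂, ⟨i⟩⟩ := hG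
  obtain ⟨w', h⟩ := shortExact_image _ _ _ (hE 0)
  refine ⟨X (0 + 1), image (d (0 + 1)), hP _, ?_, SES.of_iso_left i ⟨_, _, w', h⟩⟩
  exact ⟨fun j => X (j + 1), fun j => d (j + 1), fun j => w (j + 1), fun j => hP _,
    fun j => hE _, fun C hC j => h₁ C hC (j + 1), fun C hC j => h₂ C hC (j + 1), ⟨Iso.refl _⟩⟩

lemma isGorenstein_of_mem {P : 𝒜 → Prop} {C : 𝒜} (hC : P C) : IsGorenstein P C := by
  let d : ℤ → (C ⟶ C) := fun i => if Even i then 𝟙 C else 0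
  have he : ∀ i, Even i → d i = 𝟙 C ∧ d (i + 1) = 0 := fun i hi =>
    ⟨if_pos hi, if_neg (by grind)⟩
  have ho : ∀ i, ¬ Even i → d i = 0 ∧ d (i + 1) = 𝟙 C := fun i hi =>
    ⟨if_neg hi, if_pos (by grind)⟩
  have hd : ∀ i, d i ≫ d (i + 1) = 0 := fun i => by
    by_cases hi : Even i
    · simp [he i hi]
    · simp [ho i hi]
  have hl : ∀ (Y : 𝒜) (i : ℤ) (f : Y ⟶ C), f ≫ d (i + 1) = 0 → ∃ g : Y ⟶ C, g ≫ d i = f := by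
    intro Y i f hf
    by_cases hi : Even i
    · exact ⟨f, by simp [he i hi]⟩
    · rw [(ho i hi).2, Category.comp_id] at hf
      exact ⟨0, by simp [hf]⟩
  refine ⟨fun _ => C, d, hd, fun _ => hC, fun i => ?_, fun Y _ => hl Y, fun Y _ i f hf => ?_, ?_⟩
  · rw [ShortComplex.exact_iff_exact_up_to_refinements]
    intro T x hx
    obtain ⟨g, hg⟩ := hl T i x hx
    exact ⟨T, 𝟙 T, inferInstance, g, by simpa using hg.symm⟩
  · by_cases hi : Even i
    · rw [(he i hi).1, Category.id_comp] at hf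
      exact ⟨0, by simp [hf]⟩
    · exact ⟨f, by simp [ho i hi]⟩
  · have h0 : d 0 = 𝟙 C := if_pos (by simp)
    have : Mono (d 0) := by rw [h0]; infer_instance
    exact ⟨(imageMonoIsoSource (d 0)).symm⟩

lemma IsGorenstein.memLeftPerp [HasExt.{w} 𝒜] {P : 𝒜 → Prop}
    (horth : ∀ C, P C → MemLeftPerp P C) {G : 𝒜} (hG : IsGorenstein P G) :
    MemLeftPerp P G := by
  obtain ⟨X, d, w, hP, hE, -, h₂, ⟨e⟩⟩ := hG
  intro C hC
  have key : ∀ k : ℕ, ∀ j : ℤ, Subsingleton (Ext (image (d j)) C (k + 1)) := by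
    intro k
    induction k with
    | zero =>
      intro j
      obtain ⟨i, rfl⟩ : ∃ i : ℤ, j = i + 1 + 1 := ⟨j - 2, by ring⟩
      obtain ⟨w', h⟩ := shortExact_image _ _ _ (hE (i + 1))
      refine subsingleton_ext_one_of_extend _ _ w' h (horth _ (hP _) C hC 1 le_rfl) fun a => ?_
      obtain ⟨b, hb⟩ := h₂ C hC i (factorThruImage (d (i + 1)) ≫ a) (by
        have : d i ≫ factorThruImage (d (i + 1)) = 0 := by
          rw [← cancel_mono (Limits.image.ι (d (i + 1)))]
          simp [w]
        rw [reassoc_of% this, zero_comp])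
      exact ⟨b, by rw [← cancel_epi (factorThruImage (d (i + 1))), image.fac_assoc, hb]⟩
    | succ k ih =>
      intro j
      obtain ⟨i, rfl⟩ : ∃ i : ℤ, j = i + 1 := ⟨j - 1, by ring⟩
      obtain ⟨w', h⟩ := shortExact_image _ _ _ (hE i)
      exact SES.subsingleton_ext_left_trd ⟨_, _, w', h⟩ (ih i) (horth _ (hP _) C hC _ (by lia))
  intro i hi
  obtain ⟨k, rfl⟩ := Nat.exists_eq_add_of_le' hi
  exact subsingleton_ext_of_iso_left e.symm (key k 0)

/-- The smallest class of objects containing `P` and closed under extensions. -/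
inductive ExtClosure (P : 𝒜 → Prop) : 𝒜 → Prop
  | of {X : 𝒜} : P X → ExtClosure P X
  | ext {U V W : 𝒜} : SES U V W → ExtClosure P U → ExtClosure P W → ExtClosure P V

lemma MemRightPerp.extClosure [HasExt.{w} 𝒜] {P : 𝒜 → Prop} {A : 𝒜} (hA : MemRightPerp P A) :
    MemRightPerp (ExtClosure P) A := by
  intro X hX i hi
  induction hX with
  | of h => exact hA _ h i hi
  | ext h _ _ h₁ h₃ => exact h.subsingleton_ext_left_mid h₁ h₃

/-- Horseshoe lemma for the extension closure. -/
lemma ExtClosure.exists_ses [HasExt.{w} 𝒜] {C P : 𝒜 → Prop} (hC : IsAdditiveClass C)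
    (hP : ∀ X, P X → MemLeftPerp C X)
    (hPC : ∀ X, P X → ∃ Y X', C Y ∧ P X' ∧ SES X Y X') {X : 𝒜} (hX : ExtClosure P X) :
    ∃ Y X', C Y ∧ ExtClosure P X' ∧ SES X Y X' := by
  have hperp : ∀ Y, C Y → MemRightPerp (ExtClosure P) Y := fun Y hY =>
    MemRightPerp.extClosure fun X hX => hP X hX Y hY
  induction hX with
  | of h =>
    obtain ⟨Y, X', hY, hX', h⟩ := hPC _ h
    exact ⟨Y, X', hY, .of hX', h⟩
  | ext h _ h₃ ih₁ ih₃ =>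
    obtain ⟨Y₁, X₁', hY₁, hX₁', e₁⟩ := ih₁
    obtain ⟨Y₃, X₃', hY₃, hX₃', e₃⟩ := ih₃
    obtain ⟨Q, hQ, hQ'⟩ := h.exists_pushout e₁
    obtain ⟨i⟩ := hQ'.nonempty_iso_biprod (hperp Y₁ hY₁ _ h₃ 1 le_rfl)
    obtain ⟨Z, hZ, hZ'⟩ := hQ.exists_quotient ((e₃.biprod_left Y₁).of_iso_left i)
    exact ⟨_, Z, hC.2.2 hY₁ hY₃, .ext hZ' hX₁' hX₃', hZ⟩

lemma ResW.mono {P Q : 𝒜 → Prop} {W : ShortComplex 𝒜 → Prop} (h : ∀ X, P X → Q X)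
    {n : ℕ} {K A : 𝒜}
    (hA : ResW P W n K A) : ResW Q W n K A := by
  induction n generalizing A with
  | zero => exact hA
  | succ n ih =>
    obtain ⟨B, X, f, g, w, hX, hS, hW, hB⟩ := hA
    exact ⟨B, X, f, g, w, h X hX, hS, hW, ih hB⟩

lemma memRightPerp_of_res [HasExt.{w} 𝒜] {C F : 𝒜 → Prop} (hC : ∀ Y, C Y → MemRightPerp F Y)
    {n : ℕ} {K A : 𝒜} (hK : C K) (hA : Res C n K A) : MemRightPerp F A := by
  induction n generalizing A with
  | zero =>
    obtain ⟨i⟩ := hA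
    intro G hG j hj
    exact subsingleton_ext_of_iso_right i (hC K hK G hG j hj)
  | succ n ih =>
    obtain ⟨B, X, f, g, w, hX, hS, -, hB⟩ := hA
    intro G hG j hj
    exact SES.subsingleton_ext_right_trd ⟨f, g, w, hS⟩ (ih hB G hG _ (by lia)) (hC X hX G hG j hj)

/-- If `A` has a finite coresolution by objects of `G^⊥`, and objects of `G` embed into objects
`C` with `A ∈ C^⊥` with cokernel in `G`, then `A ∈ G^⊥`. -/
lemma memRightPerp_of_cores [HasExt.{w} 𝒜] {C D G : 𝒜 → Prop}
    (hGC : ∀ X, G X → ∃ Y X', C Y ∧ G X' ∧ SES X Y X')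
    (hD : ∀ X, D X → MemRightPerp G X) {m : ℕ} {K A : 𝒜} (hK : D K) (hA : Cores D m A K)
    (hAC : MemRightPerp C A) : MemRightPerp G A := by
  have high : ∀ X, G X → ∀ j, m < j → Subsingleton (Ext X A j) := by
    clear hAC
    intro X hX
    induction m generalizing A with
    | zero =>
      obtain ⟨i⟩ := hA
      intro j hj
      exact subsingleton_ext_of_iso_right i.symm (hD K hK X hX j hj)
    | succ m ih =>
      obtain ⟨Y, B, f, g, w, hY, hS, -, hB⟩ := hA
      intro j hj
      obtain ⟨j, rfl⟩ := Nat.exists_eq_add_of_le' (by lia : 1 ≤ j)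
      exact SES.subsingleton_ext_right_fst ⟨f, g, w, hS⟩ (hD Y hY X hX _ (by lia))
        (ih hB j (by lia))
  have key : ∀ k X, G X → ∀ j, 1 ≤ j → m < j + k → Subsingleton (Ext X A j) := by
    intro k
    induction k with
    | zero => exact fun X hX j _ hk => high X hX j hk
    | succ k ih =>
      intro X hX j hj hk
      obtain ⟨Y, X', hY, hX', h⟩ := hGC X hX
      exact h.subsingleton_ext_left_fst (hAC Y hY j hj) (ih X' hX' _ (by lia) (by lia))
  exact fun X hX j hj => key m X hX j hj (by lia)

/-- Existence of Auslander–Buchweitz hulls. -/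
lemma exists_hull {C F : 𝒜 → Prop}
    (hF : ∀ {U V W : 𝒜}, SES U V W → F U → F W → F V) (hCF : ∀ X, C X → F X)
    (h0 : C 0)
    (hFC : ∀ X, F X → ∃ Y X', C Y ∧ F X' ∧ SES X Y X') {n : ℕ} {K A : 𝒜}
    (hK : F K) (hA : Res F n K A) :
    ∃ Y G K', F G ∧ SES A Y G ∧ C K' ∧ Res C n K' Y := by
  induction n generalizing A with
  | zero =>
    obtain ⟨i⟩ := hA
    obtain ⟨Y, G, hY, hG, h⟩ := hFC A (hF (SES.of_iso i) hK (hCF 0 h0))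
    exact ⟨Y, G, Y, hG, h, hY, ⟨Iso.refl _⟩⟩
  | succ n ih =>
    obtain ⟨B, X, f, g, w, hX, hS, -, hB⟩ := hA
    obtain ⟨Y, G, K', hG, hY, hK', hres⟩ := ih hB
    obtain ⟨Q, hQ, hQ'⟩ := SES.exists_pushout ⟨f, g, w, hS⟩ hY
    obtain ⟨Z, Q', hZ, hQ'', hE⟩ := hFC Q (hF hQ hX hG)
    obtain ⟨Y', ⟨a, b, c, hs⟩, hY''⟩ := hQ'.exists_quotient hE
    exact ⟨Y', Q', K', hQ'', hY'', hK', Y, Z, a, b, c, hZ, hs, trivial, hres⟩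

lemma exists_res_of_ses [HasExt.{w} 𝒜] {C F : 𝒜 → Prop} (hC : IsAdditiveClass C)
    (hsum : ClosedUnderSummands C)
    (hperp : ∀ Y, C Y → MemRightPerp F Y) {n : ℕ} {A Y G K : 𝒜} (hA : MemRightPerp F A)
    (hG : F G) (h : SES A Y G) (hK : C K) (hY : Res C n K Y) :
    ∃ K', C K' ∧ Res C n K' A := by
  have summand : ∀ {U V W : 𝒜}, SES U V W → Subsingleton (Ext W U 1) → C V → C U ∧ C W :=
    fun h hs hV => by
      obtain ⟨i⟩ := h.nonempty_iso_biprod hs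
      exact hsum _ _ (hC.2.1 i hV)
  cases n with
  | zero =>
    obtain ⟨i⟩ := hY
    exact ⟨A, (summand h (hA G hG 1 le_rfl) (hC.2.1 i hK)).1, ⟨Iso.refl _⟩⟩
  | succ n =>
    have hYp : MemRightPerp F Y := memRightPerp_of_res hperp hK hY
    obtain ⟨B, X, f, g, w, hX, hS, -, hB⟩ := hY
    have hBp : MemRightPerp F B := memRightPerp_of_res hperp hK hB
    obtain ⟨Z, hZ, ⟨a, b, c, hs⟩⟩ := h.exists_subobject ⟨f, g, w, hS⟩
    have hZp : Subsingleton (Ext G Z 1) := SES.subsingleton_ext_right_mid ⟨a, b, c, hs⟩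
      (hBp G hG 1 le_rfl) (hA G hG 1 le_rfl)
    exact ⟨K, hK, B, Z, a, b, c, (summand hZ hZp hX).1, hs, trivial, hB⟩

end Gorenstein

end RelHomDim

open RelHomDim in
/-- Corollary 3.13. -/
theorem stmt15 {𝒜 : Type u} [Category.{v} 𝒜] [Abelian 𝒜] [HasExt.{w} 𝒜]
    (𝒞 𝒟 : 𝒜 → Prop) (h𝒞 : IsAdditiveClass 𝒞) (h𝒟 : IsAdditiveClass 𝒟)
    (horth : ∀ C₁ C₂ : 𝒜, 𝒞 C₁ → 𝒞 C₂ → ∀ i : ℕ, 1 ≤ i →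
      Subsingleton (Abelian.Ext C₁ C₂ i))
    (hsum : ClosedUnderSummands 𝒞)
    (h𝒟G : ∀ X : 𝒜, 𝒟 X → MemRightPerp (IsGorenstein 𝒞) X)
    (A : 𝒜) (hA : MemRightPerp 𝒞 A) (hcodim : rcodim 𝒟 A < ⊤) :
    rdim (IsGorenstein 𝒞) A = rdim 𝒞 A := by
  have hC0 : 𝒞 0 := h𝒞.1
  have hleft : ∀ C, 𝒞 C → MemLeftPerp 𝒞 C := fun C hC C' hC' => horth C C' hC hC'
  have hGperp : ∀ G, IsGorenstein 𝒞 G → MemLeftPerp 𝒞 G := fun G hG => hG.memLeftPerp hleft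
  have hGC : ∀ G, IsGorenstein 𝒞 G → ∃ Y G', 𝒞 Y ∧ IsGorenstein 𝒞 G' ∧ SES G Y G' :=
    fun G hG => hG.exists_ses
  have hCF : ∀ X, 𝒞 X → ExtClosure (IsGorenstein 𝒞) X := fun X hX => .of (isGorenstein_of_mem hX)
  have hFC : ∀ X, ExtClosure (IsGorenstein 𝒞) X →
      ∃ Y X', 𝒞 Y ∧ ExtClosure (IsGorenstein 𝒞) X' ∧ SES X Y X' :=
    fun X hX => hX.exists_ses h𝒞 hGperp hGC
  have hperp : ∀ Y, 𝒞 Y → MemRightPerp (ExtClosure (IsGorenstein 𝒞)) Y := fun Y hY =>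
    MemRightPerp.extClosure fun X hX => hGperp X hX Y hY
  have hAF : MemRightPerp (ExtClosure (IsGorenstein 𝒞)) A := by
    obtain ⟨_, ⟨m, -, K, hK, hcores⟩, -⟩ := sInf_lt_iff.1 hcodim
    exact (memRightPerp_of_cores hGC h𝒟G hK hcores hA).extClosure
  refine le_antisymm (sInf_le_sInf ?_) (sInf_le_sInf ?_)
  · rintro _ ⟨n, rfl, K, hK, hres⟩
    exact ⟨n, rfl, K, isGorenstein_of_mem hK, hres.mono fun _ => isGorenstein_of_mem⟩
  · rintro _ ⟨n, rfl, K, hK, hres⟩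
    obtain ⟨Y, G, K', hG, h, hK', hY⟩ :=
      exists_hull .ext hCF hC0 hFC (.of hK) (hres.mono fun _ => .of)
    exact ⟨n, rfl, exists_res_of_ses h𝒞 hsum hperp hAF hG h hK' hY⟩
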